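/- The maximum of T over Ω_n satisfies log(max_{f ∈ Ω_n} T(f)) = √(n log n) · (1 + o(1)) as n → ∞; that is, log(max_{f ∈ Ω_n} T(f)) / √(n log n) tends to 1. -/

import Mathlib

open scoped Classical
open Function

namespace IterMap

noncomputable section

/-- A vertex `v` is cyclic for `f` if some positive iterate of `f` fixes `v`. -/
def IsCyclic {n : ℕ} (f : Fin n → Fin n) (v : Fin n) : Prop :=
  ∃ t, 0 < t ∧ f^[t] v = v

theorem isCyclic_apply {n : ℕ} {f : Fin n → Fin n} {v : Fin n} (h : IsCyclic f v) :
    IsCyclic f (f v) := by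
  obtain ⟨t, ht, hv⟩ := h
  refine ⟨t, ht, ?_⟩
  calc f^[t] (f v) = f^[t + 1] v := (Function.iterate_succ_apply f t v).symm
    _ = f (f^[t] v) := Function.iterate_succ_apply' f t v
    _ = f v := by rw [hv]

/-- The permutation induced by `f` on its cyclic vertices. -/
def cyclicPerm {n : ℕ} (f : Fin n → Fin n) :
    Equiv.Perm {v : Fin n // IsCyclic f v} :=
  Equiv.ofBijective (fun v => ⟨f v.1, isCyclic_apply v.2⟩) (by
    rw [← Finite.injective_iff_bijective]
    intro u v huv
    have h1 : f u.1 = f v.1 := congrArg Subtype.val huv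
    obtain ⟨s, hs, hsu⟩ := u.2
    obtain ⟨t, ht, htv⟩ := v.2
    have hu : f^[s * t] u.1 = u.1 := by
      rw [Function.iterate_mul]
      exact Function.iterate_fixed hsu t
    have hv : f^[s * t] v.1 = v.1 := by
      rw [mul_comm, Function.iterate_mul]
      exact Function.iterate_fixed htv s
    have hst : 0 < s * t := Nat.mul_pos hs ht
    obtain ⟨k, hk⟩ : ∃ k, s * t = k + 1 := ⟨s * t - 1, by omega⟩
    apply Subtype.ext
    calc u.1 = f^[s * t] u.1 := hu.symm
      _ = f^[k] (f u.1) := by rw [hk, Function.iterate_succ_apply]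
      _ = f^[k] (f v.1) := by rw [h1]
      _ = f^[s * t] v.1 := by rw [hk, Function.iterate_succ_apply]
      _ = v.1 := hv)

/-- `T f`: the (eventual) period of the sequence of iterates of `f`. -/
def T {n : ℕ} (f : Fin n → Fin n) : ℕ :=
  sInf {T : ℕ | 0 < T ∧ ∀ m, n ≤ m → f^[m + T] = f^[m]}

/-- `B f`: the product of the lengths of the cycles of `f`. -/
def B {n : ℕ} (f : Fin n → Fin n) : ℕ :=
  (cyclicPerm f).cycleType.prod

/-- `Z f`: the number of cyclic vertices of `f`. -/
def Z {n : ℕ} (f : Fin n → Fin n) : ℕ :=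
  Nat.card {v : Fin n // IsCyclic f v}

/-- `O f`: the number of distinct positive iterates of `f`. -/
def O {n : ℕ} (f : Fin n → Fin n) : ℕ :=
  Nat.card {g : Fin n → Fin n // ∃ t, 0 < t ∧ g = f^[t]}

/-- `f` is connected if its functional graph has one weak component. -/
def Connected {n : ℕ} (f : Fin n → Fin n) : Prop :=
  ∀ u v : Fin n, ∃ s t : ℕ, f^[s] u = f^[t] v

/-- The set of connected mappings on `[n]`. -/
def Un (n : ℕ) : Finset (Fin n → Fin n) :=
  Finset.univ.filter fun f => Connected f

/-- `kappa n`: the average cycle length of a uniform random connected mapping. -/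
def kappa (n : ℕ) : ℝ :=
  (∑ f ∈ Un n, (Z f : ℝ)) / (Un n).card

def c (d : ℕ) : ℝ :=
  ((kappa d - 1) / d) * Real.exp (-(d : ℝ)) *
    ∑ k ∈ Finset.range d, (d : ℝ) ^ k / (k.factorial : ℝ)

def F (z : ℝ) : ℝ := (1 / (1 - z)) * Real.exp (∑' d : ℕ, c d * z ^ d)

def mu (m : ℕ) : ℝ := iteratedDeriv m F 0 / (m.factorial : ℝ)

def g (s : ℝ) : ℝ := ∑' d : ℕ, c d * Real.exp (-(d : ℝ) * s)

/-- `M m`: the average order of a uniform random permutation of `[m]`. -/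
def M (m : ℕ) : ℝ :=
  (∑ σ : Equiv.Perm (Fin m), (orderOf σ : ℝ)) / (m.factorial : ℝ)

def I : ℝ :=
  ∫ t in Set.Ioi (0 : ℝ), Real.log (Real.log (Real.exp 1 / (1 - Real.exp (-t))))

def beta0 : ℝ := Real.sqrt (8 * I)

def k0 : ℝ := (3 / 2) * (3 * I) ^ ((2 : ℝ) / 3)

end

end IterMap

section
open MeasureTheory Filter Topology Set

namespace LandauPNT

noncomputable def fej (v : ℝ) : ℝ := (Real.sinc (v/2))^2

lemma fej_nonneg (v : ℝ) : 0 ≤ fej v := sq_nonneg _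

lemma fej_cont : Continuous fej := by
  unfold fej
  have := Real.continuous_sinc
  fun_prop

lemma fej_zero : fej 0 = 1 := by simp [fej]

lemma fej_eq {v : ℝ} (hv : v ≠ 0) : fej v = 2 * (1 - Real.cos v) / v^2 := by
  have h : Real.cos v = 1 - 2 * Real.sin (v/2)^2 := by
    have := Real.cos_two_mul (v/2)
    rw [show 2 * (v/2) = v by ring] at this
    have h2 := Real.sin_sq_add_cos_sq (v/2)
    rw [this]; linarith
  rw [fej, Real.sinc_of_ne_zero (by simpa using hv), h]
  field_simp
  ring

lemma fej_le_one (v : ℝ) : fej v ≤ 1 := by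
  unfold fej
  have := Real.abs_sinc_le_one (v/2)
  exact (sq_le_one_iff_abs_le_one _).mpr this

lemma fej_le (v : ℝ) : fej v ≤ 5 * (1 + v^2)⁻¹ := by
  rw [← div_eq_mul_inv, le_div_iff₀ (by positivity)]
  by_cases hv : v = 0
  · subst hv; rw [fej_zero]; norm_num
  have h1 := fej_le_one v
  have h2 : fej v * v^2 ≤ 4 := by
    rw [fej_eq hv, div_mul_cancel₀ _ (by positivity)]
    linarith [Real.neg_one_le_cos v]
  nlinarith

lemma fej_integrable : Integrable fej := by
  refine Integrable.mono' (integrable_inv_one_add_sq.const_mul 5) fej_cont.aestronglyMeasurable ?_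
  filter_upwards with v
  rw [Real.norm_of_nonneg (fej_nonneg v)]
  exact fej_le v

lemma fej_int_pos : 0 < ∫ v, fej v := by
  refine integral_pos_of_integrable_nonneg_nonzero (x := 0) fej_cont fej_integrable
    (fun v => fej_nonneg v) ?_
  rw [fej_zero]; norm_num

lemma fej_half (c : ℂ) (hc : c ≠ 0) :
    ∫ t in (0:ℝ)..1, ((1 - t : ℝ) : ℂ) * Complex.exp (c * t) =
      Complex.exp c / c^2 - 1 / c - 1 / c^2 := by
  have h : ∀ t ∈ uIcc (0:ℝ) 1, HasDerivAt (fun t : ℝ => ((1 - t : ℝ) : ℂ) * Complex.exp (c * t) / c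
      + Complex.exp (c * t) / c^2) (((1 - t : ℝ) : ℂ) * Complex.exp (c * t)) t := by
    intro t _
    have h1 : HasDerivAt (fun t : ℝ => Complex.exp (c * t)) (Complex.exp (c * t) * (c * 1)) t :=
      (((hasDerivAt_id _).ofReal_comp).const_mul c).cexp
    have h2 : HasDerivAt (fun t : ℝ => ((1 - t : ℝ) : ℂ)) ((-1 : ℝ) : ℂ) t := by
      have := ((hasDerivAt_id t).const_sub 1).ofReal_comp
      simpa using this
    convert! ((h2.mul h1).div_const c).add (h1.div_const (c^2)) using 1
    push_cast
    field_simp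
    ring
  rw [intervalIntegral.integral_eq_sub_of_hasDerivAt h]
  · simp; ring
  · apply Continuous.intervalIntegrable
    fun_prop

lemma fej_fourier (v : ℝ) (hv : v ≠ 0) :
    ∫ t in (-1:ℝ)..1, ((1 - |t| : ℝ) : ℂ) * Complex.exp (Complex.I * v * t) = (fej v : ℂ) := by
  have hc : Complex.I * (v:ℂ) ≠ 0 := by simp [hv]
  have hi : ∀ a b : ℝ, IntervalIntegrable
      (fun t : ℝ => ((1 - |t| : ℝ) : ℂ) * Complex.exp (Complex.I * v * t)) volume a b := by
    intro a b
    apply Continuous.intervalIntegrable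
    fun_prop
  rw [← intervalIntegral.integral_add_adjacent_intervals (hi (-1) 0) (hi 0 1)]
  have e1 : ∫ t in (0:ℝ)..1, ((1 - |t| : ℝ) : ℂ) * Complex.exp (Complex.I * v * t) =
      ∫ t in (0:ℝ)..1, ((1 - t : ℝ) : ℂ) * Complex.exp ((Complex.I * v) * t) := by
    apply intervalIntegral.integral_congr
    intro t ht
    rw [uIcc_of_le (by norm_num)] at ht
    simp only [abs_of_nonneg ht.1]
  have e2 : ∫ t in (-1:ℝ)..0, ((1 - |t| : ℝ) : ℂ) * Complex.exp (Complex.I * v * t) =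
      ∫ t in (0:ℝ)..1, ((1 - t : ℝ) : ℂ) * Complex.exp ((-(Complex.I * v)) * t) := by
    have := intervalIntegral.integral_comp_neg (a := 0) (b := 1)
      (fun t : ℝ => ((1 - |t| : ℝ) : ℂ) * Complex.exp (Complex.I * v * t))
    rw [neg_zero] at this
    rw [← this]
    apply intervalIntegral.integral_congr
    intro t ht
    rw [uIcc_of_le (by norm_num)] at ht
    simp only [abs_neg, abs_of_nonneg ht.1]
    push_cast
    ring_nf
  rw [e1, e2, fej_half _ hc, fej_half _ (neg_ne_zero.mpr hc), fej_eq hv]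
  push_cast
  rw [Complex.cos]
  rw [show (v:ℂ) * Complex.I = Complex.I * v by ring, show -(v:ℂ) * Complex.I = -(Complex.I * v) by ring]
  have hv' : (v:ℂ) ≠ 0 := by simpa using hv
  field_simp
  simp only [Complex.I_sq]
  field_simp
  ring

end LandauPNT

end

section
open MeasureTheory Filter Topology Set

namespace LandauPNT

lemma fej_shift_integrable (l y : ℝ) (hl : 0 < l) : Integrable (fun u => fej (l * (y - u))) := by
  have h := (fej_integrable.comp_mul_left' hl.ne').comp_sub_left y
  exact h

lemma swap_identity (h : ℝ → ℝ) (hm : Measurable h) (M : ℝ) (hM : ∀ u, |h u| ≤ M)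
    (G : ℂ → ℂ)
    (hG : ∀ s : ℂ, 0 < s.re → ∫ u in Ioi (0:ℝ), (h u : ℂ) * Complex.exp (-s * u) = G s)
    (l y d : ℝ) (hl : 0 < l) (hd : 0 < d) :
    ∫ t in (-1:ℝ)..1, ((1 - |t| : ℝ) : ℂ) * Complex.exp (Complex.I * (l * t * y)) *
        G (d + Complex.I * (l * t))
      = ∫ u in Ioi (0:ℝ), (h u : ℂ) * Complex.exp (-d * u) * (fej (l * (y - u)) : ℂ) := by
  rw [intervalIntegral.integral_of_le (by norm_num)]
  have e1 : ∀ t : ℝ, ((1 - |t| : ℝ) : ℂ) * Complex.exp (Complex.I * (l * t * y)) *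
        G (d + Complex.I * (l * t)) = ∫ u in Ioi (0:ℝ),
        (((1 - |t| : ℝ) : ℂ) * Complex.exp (Complex.I * (l * t * y))) * ((h u : ℂ) *
        Complex.exp (-(d + Complex.I * (l * t)) * u)) := by
    intro t
    rw [integral_const_mul, hG _ (by simp [hd])]
  simp_rw [e1]
  rw [integral_integral_swap]
  · apply integral_congr_ae
    have hne : ∀ᵐ u : ℝ ∂(volume.restrict (Ioi 0)), u ≠ y := by
      apply ae_restrict_of_ae
      simp [ae_iff]
    filter_upwards [hne] with u hu
    have hv : l * (y - u) ≠ 0 := mul_ne_zero hl.ne' (sub_ne_zero.mpr (Ne.symm hu))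
    rw [← fej_fourier _ hv, intervalIntegral.integral_of_le (by norm_num), ← integral_const_mul]
    congr 1
    ext t
    have : Complex.exp (Complex.I * (l * t * y)) * Complex.exp (-(d + Complex.I * (l * t)) * u)
      = Complex.exp (-d * u) * Complex.exp (Complex.I * ((l * (y - u) : ℝ) : ℂ) * t) := by
      rw [← Complex.exp_add, ← Complex.exp_add]
      congr 1
      push_cast
      ring
    linear_combination ((1 - |t| : ℝ) : ℂ) * (h u : ℂ) * this
  · have hint : Integrable (fun u : ℝ => M * Real.exp (-d * u)) (volume.restrict (Ioi 0)) :=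
      (integrableOn_exp_mul_Ioi (by linarith) 0).const_mul M
    have h2 : Integrable (fun z : ℝ × ℝ => (1:ℝ) * (M * Real.exp (-d * z.2)))
        ((volume.restrict (Ioc (-1) 1)).prod (volume.restrict (Ioi 0))) :=
      (integrable_const (1:ℝ)).mul_prod hint
    refine Integrable.mono' h2 ?_ ?_
    · apply Measurable.aestronglyMeasurable
      simp only [Function.uncurry_def]
      fun_prop
    · have : ∀ᵐ z : ℝ × ℝ ∂((volume.restrict (Ioc (-1) 1)).prod (volume.restrict (Ioi 0))),
          z ∈ (Ioc (-1:ℝ) 1) ×ˢ (Ioi (0:ℝ)) := by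
        rw [Measure.prod_restrict]
        exact ae_restrict_mem (measurableSet_Ioc.prod measurableSet_Ioi)
      filter_upwards [this] with z hz
      obtain ⟨h3, h4⟩ := hz
      simp only [Function.uncurry_def, norm_mul, Complex.norm_exp, Complex.norm_real]
      have h5 : |z.1| ≤ 1 := abs_le.mpr ⟨h3.1.le, h3.2⟩
      have h6 : ‖1 - |z.1|‖ ≤ 1 := by
        rw [Real.norm_eq_abs, abs_le]; constructor <;> linarith [abs_nonneg z.1]
      have h7 : (Complex.I * ((l:ℂ) * (z.1:ℂ) * (y:ℂ))).re = 0 := by simp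
      have h8 : (-((d:ℂ) + Complex.I * ((l:ℂ) * (z.1:ℂ))) * (z.2:ℂ)).re = -d * z.2 := by simp
      rw [h7, h8, Real.exp_zero, mul_one]
      gcongr
      exact hM _

lemma limit_identity (h : ℝ → ℝ) (hm : Measurable h) (M : ℝ) (hM : ∀ u, |h u| ≤ M)
    (G : ℂ → ℂ) (hGc : ContinuousOn G {s | 0 ≤ s.re})
    (hG : ∀ s : ℂ, 0 < s.re → ∫ u in Ioi (0:ℝ), (h u : ℂ) * Complex.exp (-s * u) = G s)
    (l y : ℝ) (hl : 0 < l) :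
    ∫ t in (-1:ℝ)..1, ((1 - |t| : ℝ) : ℂ) * Complex.exp (Complex.I * (l * t * y)) *
        G (Complex.I * (l * t))
      = ((∫ u in Ioi (0:ℝ), h u * fej (l * (y - u)) : ℝ) : ℂ) := by
  let D : ℕ → ℝ := fun n => 1 / ((n:ℝ) + 1)
  have hD0 : Tendsto D atTop (𝓝 0) := tendsto_one_div_add_atTop_nhds_zero_nat
  have hDpos : ∀ n, 0 < D n := fun n => by positivity
  have hD1 : ∀ n, D n ≤ 1 := fun n => by
    simp only [D]; rw [div_le_one (by positivity)]; linarith [(Nat.cast_nonneg n : (0:ℝ) ≤ n)]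
  have hR : Tendsto (fun n => ∫ u in Ioi (0:ℝ), (h u : ℂ) * Complex.exp (-(D n) * u) *
      (fej (l * (y - u)) : ℂ)) atTop (𝓝 (((∫ u in Ioi (0:ℝ), h u * fej (l * (y - u)) : ℝ) : ℂ))) := by
    rw [← integral_complex_ofReal]
    refine tendsto_integral_of_dominated_convergence (fun u => M * fej (l * (y - u))) ?_ ?_ ?_ ?_
    · intro n
      apply Measurable.aestronglyMeasurable
      have := fej_cont.measurable
      fun_prop
    · exact ((fej_shift_integrable l y hl).const_mul M).integrableOn
    · intro n
      filter_upwards [ae_restrict_mem measurableSet_Ioi] with u hu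
      rw [norm_mul, norm_mul, Complex.norm_real, Complex.norm_real, Complex.norm_exp,
        Real.norm_of_nonneg (fej_nonneg _), Real.norm_eq_abs]
      have : (-((D n : ℝ):ℂ) * (u:ℂ)).re = -(D n * u) := by simp
      rw [this]
      have h1 : Real.exp (-(D n * u)) ≤ 1 := by
        rw [Real.exp_le_one_iff]; have := mul_pos (hDpos n) hu; linarith
      have := fej_nonneg (l * (y - u))
      gcongr
      calc |h u| * Real.exp (-(D n * u)) ≤ |h u| * 1 := by gcongr
        _ ≤ M := by rw [mul_one]; exact hM u
    · filter_upwards with u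
      push_cast
      apply Tendsto.mul_const
      have : Tendsto (fun n => Complex.exp (-(D n : ℂ) * u)) atTop (𝓝 1) := by
        have hc : Continuous (fun x : ℝ => Complex.exp (-(x : ℂ) * u)) := by fun_prop
        have := (hc.tendsto 0).comp hD0
        simpa [Function.comp_def] using this
      simpa using this.const_mul (h u : ℂ)
  have hset : IsCompact ((Icc (0:ℝ) 1) ×ˢ (Icc (-1:ℝ) 1)) := isCompact_Icc.prod isCompact_Icc
  have hcont : ContinuousOn (fun z : ℝ × ℝ => G (z.1 + Complex.I * (l * z.2)))
      ((Icc (0:ℝ) 1) ×ˢ (Icc (-1:ℝ) 1)) := by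
    refine hGc.comp (by fun_prop) ?_
    intro z hz
    simpa using hz.1.1
  obtain ⟨C, hC⟩ := hset.exists_bound_of_continuousOn hcont
  have hL : Tendsto (fun n => ∫ t in (-1:ℝ)..1, ((1 - |t| : ℝ) : ℂ) *
      Complex.exp (Complex.I * (l * t * y)) * G (D n + Complex.I * (l * t))) atTop
      (𝓝 (∫ t in (-1:ℝ)..1, ((1 - |t| : ℝ) : ℂ) * Complex.exp (Complex.I * (l * t * y)) *
        G (Complex.I * (l * t)))) := by
    rw [intervalIntegral.integral_of_le (by norm_num)]
    simp_rw [intervalIntegral.integral_of_le (show (-1:ℝ) ≤ 1 by norm_num)]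
    refine tendsto_integral_of_dominated_convergence (fun u => C) ?_ ?_ ?_ ?_
    · intro n
      apply ContinuousOn.aestronglyMeasurable _ measurableSet_Ioc
      refine ContinuousOn.mul (by fun_prop) ?_
      have := hcont.comp (f := fun t : ℝ => (D n, t)) (s := Ioc (-1:ℝ) 1) (by fun_prop) ?_
      · exact this
      · intro t ht
        exact ⟨⟨(hDpos n).le, hD1 n⟩, ht.1.le, ht.2⟩
    · exact integrable_const _
    · intro n
      filter_upwards [ae_restrict_mem measurableSet_Ioc] with t ht
      have h1 := hC (D n, t) ⟨⟨(hDpos n).le, hD1 n⟩, ht.1.le, ht.2⟩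
      have h5 : |t| ≤ 1 := abs_le.mpr ⟨ht.1.le, ht.2⟩
      have h6 : ‖1 - |t|‖ ≤ 1 := by
        rw [Real.norm_eq_abs, abs_le]; constructor <;> linarith [abs_nonneg t]
      have h7 : (Complex.I * ((l:ℂ) * (t:ℂ) * (y:ℂ))).re = 0 := by simp
      rw [norm_mul, norm_mul, Complex.norm_exp, Complex.norm_real, h7, Real.exp_zero, mul_one]
      calc _ ≤ 1 * C := by
            gcongr
        _ = C := one_mul _
    · filter_upwards [ae_restrict_mem measurableSet_Ioc] with t ht
      apply Tendsto.const_mul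
      have h1 : ContinuousWithinAt G {s | 0 ≤ s.re} (Complex.I * (l * t)) := hGc _ (by simp)
      refine h1.tendsto.comp ?_
      rw [tendsto_nhdsWithin_iff]
      constructor
      · have hc : Continuous (fun x : ℝ => (x:ℂ) + Complex.I * (l * t)) := by fun_prop
        have := (hc.tendsto 0).comp hD0
        simpa [Function.comp_def] using this
      · filter_upwards with n
        simpa using (hDpos n).le
  refine tendsto_nhds_unique hL (hR.congr ?_)
  intro n
  rw [swap_identity h hm M hM G hG l y (D n) hl (hDpos n)]

lemma wiener_tendsto (h : ℝ → ℝ) (hm : Measurable h) (M : ℝ) (hM : ∀ u, |h u| ≤ M)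
    (G : ℂ → ℂ) (hGc : ContinuousOn G {s | 0 ≤ s.re})
    (hG : ∀ s : ℂ, 0 < s.re → ∫ u in Ioi (0:ℝ), (h u : ℂ) * Complex.exp (-s * u) = G s)
    (l : ℝ) (hl : 0 < l) :
    Tendsto (fun y => ∫ u in Ioi (0:ℝ), h u * fej (l * (y - u))) atTop (𝓝 0) := by
  have key := Real.tendsto_integral_exp_smul_cocompact
    ((Ioc (-1:ℝ) 1).indicator (fun t : ℝ => ((1 - |t| : ℝ) : ℂ) * G (Complex.I * (l * t))))
  have h1 : Tendsto (fun y : ℝ => -(l * y / (2 * Real.pi))) atTop (cocompact ℝ) := by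
    have : Tendsto (fun y : ℝ => -(l * y / (2 * Real.pi))) atTop atBot := by
      apply tendsto_neg_atTop_atBot.comp
      exact (tendsto_id.const_mul_atTop hl).atTop_div_const (by positivity)
    exact this.mono_right atBot_le_cocompact
  have h2 := key.comp h1
  have h3 : Tendsto (fun y => ((∫ u in Ioi (0:ℝ), h u * fej (l * (y - u)) : ℝ) : ℂ)) atTop (𝓝 0) := by
    refine h2.congr ?_
    intro y
    rw [← limit_identity h hm M hM G hGc hG l y hl,
      intervalIntegral.integral_of_le (by norm_num), ← integral_indicator measurableSet_Ioc]
    simp only [Function.comp]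
    congr 1
    ext t
    by_cases ht : t ∈ Ioc (-1:ℝ) 1
    · simp only [indicator_of_mem ht]
      rw [Circle.smul_def, Real.fourierChar_apply, smul_eq_mul]
      have : (((2 * Real.pi * -(t * -(l * y / (2 * Real.pi))) : ℝ) : ℂ) * Complex.I)
        = Complex.I * (l * t * y) := by
        push_cast
        have : (Real.pi : ℂ) ≠ 0 := by exact_mod_cast Real.pi_ne_zero
        field_simp
      rw [this]; ring
    · simp only [indicator_of_notMem ht, smul_zero]
  have := (Complex.continuous_re.tendsto 0).comp h3
  simpa [Function.comp_def] using this

end LandauPNT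

end

section
open MeasureTheory Filter Topology Set

namespace LandauPNT

lemma exists_scale (e η M : ℝ) (he : 0 < e) (hη : 0 < η) (hM : 0 ≤ M) :
    ∃ l > 0, 0 < (e + M) * (∫ v in (-η)..η, fej (l * v)) - M * ∫ v, fej (l * v) := by
  have h1 : Tendsto (fun l : ℝ => ∫ v in (l * (-η))..(l * η), fej v) atTop (𝓝 (∫ v, fej v)) := by
    apply intervalIntegral_tendsto_integral fej_integrable
    · exact tendsto_id.atTop_mul_const_of_neg (by linarith)
    · exact tendsto_id.atTop_mul_const hη
  have hc := fej_int_pos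
  have h2 : Tendsto (fun l : ℝ => (e + M) * (∫ v in (l * (-η))..(l * η), fej v) - M * ∫ v, fej v)
      atTop (𝓝 ((e + M) * (∫ v, fej v) - M * ∫ v, fej v)) := (h1.const_mul _).sub_const _
  have h3 : 0 < (e + M) * (∫ v, fej v) - M * ∫ v, fej v := by nlinarith
  obtain ⟨l, hl, hl0⟩ := ((h2.eventually_const_lt h3).and (eventually_gt_atTop 0)).exists
  refine ⟨l, hl0, ?_⟩
  rw [intervalIntegral.integral_comp_mul_left _ hl0.ne', Measure.integral_comp_mul_left,
    abs_of_pos (inv_pos.mpr hl0), smul_eq_mul, smul_eq_mul]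
  have : (e + M) * (l⁻¹ * ∫ v in (l * (-η))..(l * η), fej v) - M * (l⁻¹ * ∫ v, fej v) =
    l⁻¹ * ((e + M) * (∫ v in (l * (-η))..(l * η), fej v) - M * ∫ v, fej v) := by ring
  rw [this]
  exact mul_pos (inv_pos.mpr hl0) hl

lemma core (g : ℝ → ℝ) (hm : Measurable g) (M : ℝ) (hM : ∀ u, |g u| ≤ M)
    (hJ : ∀ l > 0, Tendsto (fun y => ∫ u in Ioi (0:ℝ), g u * fej (l * (y - u))) atTop (𝓝 0))
    (e η : ℝ) (he : 0 < e) (hη : 0 < η) :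
    ∀ᶠ z in atTop, ¬ ∀ u ∈ Icc (z - η) (z + η), e ≤ g u := by
  have hM0 : 0 ≤ M := (abs_nonneg _).trans (hM 0)
  obtain ⟨l, hl, hpos⟩ := exists_scale e η M he hη hM0
  filter_upwards [(hJ l hl).eventually_lt_const hpos, eventually_gt_atTop η] with z hz hz0 hall
  refine absurd hz (not_lt.mpr ?_)
  have hi := fej_shift_integrable l z hl
  have e1 : ∫ v in (-η)..η, fej (l * v) = ∫ u in Icc (z - η) (z + η), fej (l * (z - u)) := by
    rw [integral_Icc_eq_integral_Ioc, ← intervalIntegral.integral_of_le (by linarith),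
      intervalIntegral.integral_comp_sub_left (fun v => fej (l * v))]
    congr 1 <;> ring
  have e2 : ∫ v, fej (l * v) = ∫ u, fej (l * (z - u)) :=
    (integral_sub_left_eq_self (fun v => fej (l * v)) volume z).symm
  rw [e1, e2, ← integral_indicator measurableSet_Icc, ← integral_indicator measurableSet_Ioi,
    ← integral_const_mul, ← integral_const_mul, ← integral_sub]
  · apply integral_mono
    · exact ((hi.indicator measurableSet_Icc).const_mul _).sub (hi.const_mul _)
    · apply Integrable.indicator _ measurableSet_Ioi
      refine Integrable.mono' (hi.const_mul M) ?_ ?_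
      · apply Measurable.aestronglyMeasurable
        have := fej_cont.measurable
        fun_prop
      · filter_upwards with u
        rw [norm_mul, Real.norm_of_nonneg (fej_nonneg _)]
        exact mul_le_mul_of_nonneg_right (hM u) (fej_nonneg _)
    · intro u
      have hf := fej_nonneg (l * (z - u))
      by_cases hu : u ∈ Icc (z - η) (z + η)
      · have hu0 : u ∈ Ioi (0:ℝ) := by have := hu.1; simp only [mem_Ioi]; linarith
        simp only [indicator_of_mem hu, indicator_of_mem hu0]
        have := hall u hu
        nlinarith
      · simp only [indicator_of_notMem hu]
        by_cases hu0 : u ∈ Ioi (0:ℝ)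
        · simp only [indicator_of_mem hu0]
          have := (abs_le.mp (hM u)).1
          nlinarith
        · simp only [indicator_of_notMem hu0]
          nlinarith
  · exact (hi.indicator measurableSet_Icc).const_mul _
  · exact hi.const_mul _

lemma tauberian (h : ℝ → ℝ) (hm : Measurable h) (M : ℝ) (hM : ∀ u, |h u| ≤ M)
    (G : ℂ → ℂ) (hGc : ContinuousOn G {s | 0 ≤ s.re})
    (hG : ∀ s : ℂ, 0 < s.re → ∫ u in Ioi (0:ℝ), (h u : ℂ) * Complex.exp (-s * u) = G s)
    (hmono : ∀ u v, u ≤ v → Real.exp u * (1 + h u) ≤ Real.exp v * (1 + h v))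
    (hnn : ∀ u, 0 ≤ 1 + h u) :
    Tendsto h atTop (𝓝 0) := by
  have hJ := fun l hl => wiener_tendsto h hm M hM G hGc hG l hl
  have hmono' : ∀ u v, u ≤ v → (1 + h u) ≤ Real.exp (v - u) * (1 + h v) := by
    intro u v huv
    have := hmono u v huv
    rw [Real.exp_sub, div_mul_eq_mul_div, le_div_iff₀ (Real.exp_pos _)]
    linarith
  rw [Metric.tendsto_nhds]
  intro ε0 hε0
  obtain ⟨ε, hε, hε1, hεε⟩ : ∃ ε : ℝ, 0 < ε ∧ ε < 1 ∧ ε < ε0 :=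
    ⟨min (1/2) (ε0/2), by positivity, by
      exact (min_le_left _ _).trans_lt (by norm_num), (min_le_right _ _).trans_lt (by linarith)⟩
  have c1 := core h hm M hM hJ (ε/2) (ε/8) (by linarith) (by linarith)
  have c2 := core (fun u => - h u) hm.neg M (by simpa using hM) (by
    intro l hl
    have := (hJ l hl).neg
    simpa [integral_neg] using this) (ε/2) (ε/8) (by linarith) (by linarith)
  have c1' := (tendsto_atTop_add_const_right atTop (ε/8) tendsto_id).eventually c1
  have c2' := (tendsto_atTop_add_const_right atTop (-(ε/8)) tendsto_id).eventually c2
  have hexp : Real.exp (ε/4) * (1 - ε/4) ≤ 1 := by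
    have h1 := Real.add_one_le_exp (-(ε/4))
    have h2 : Real.exp (ε/4) * Real.exp (-(ε/4)) = 1 := by rw [← Real.exp_add]; simp
    have := Real.exp_pos (ε/4)
    nlinarith
  filter_upwards [c1', c2'] with y h1 h2
  simp only [id] at h1 h2
  rw [Real.dist_eq, sub_zero]
  refine lt_of_le_of_lt ?_ hεε
  rw [abs_le]
  constructor
  · by_contra hcon
    push Not at hcon
    apply h2
    intro u hu
    have a1 := hmono' u y (by linarith [hu.2])
    have a2 : Real.exp (y - u) ≤ Real.exp (ε/4) := Real.exp_le_exp.mpr (by linarith [hu.1])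
    have a3 := hnn y
    have a4 : Real.exp (y - u) * (1 + h y) ≤ Real.exp (ε/4) * (1 - ε) := by
      apply mul_le_mul a2 (by linarith) a3 (Real.exp_pos _).le
    have a5 := Real.exp_pos (ε/4)
    have a6 : Real.exp (ε/4) * (1 - ε) ≤ 1 - ε/2 := by
      have : 1 - ε ≤ (1 - ε/4) * (1 - ε/2) := by nlinarith
      nlinarith
    linarith
  · by_contra hcon
    push Not at hcon
    apply h1
    intro u hu
    have a1 := hmono' y u (by linarith [hu.1])
    have a2 : Real.exp (u - y) ≤ Real.exp (ε/4) := Real.exp_le_exp.mpr (by linarith [hu.2])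
    have a3 := hnn u
    have a4 : Real.exp (u - y) * (1 + h u) ≤ Real.exp (ε/4) * (1 + h u) := by gcongr
    have a5 : (1 + ε) * (1 - ε/4) ≤ 1 + h u := by
      have b1 : 1 + ε ≤ Real.exp (ε/4) * (1 + h u) := by linarith
      have b2 : (1 + ε) * (1 - ε/4) ≤ (Real.exp (ε/4) * (1 + h u)) * (1 - ε/4) := by
        apply mul_le_mul_of_nonneg_right b1; linarith
      have b3 : (Real.exp (ε/4) * (1 - ε/4)) * (1 + h u) ≤ 1 * (1 + h u) := by gcongr
      nlinarith
    nlinarith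

end LandauPNT

end

section
open MeasureTheory Filter Topology Set Chebyshev

namespace LandauPNT

lemma psi_laplace (s : ℂ) (hs : 0 < s.re) :
    ∫ u in Ioi (0:ℝ), (ψ (Real.exp u) * Real.exp (-u) : ℂ) * Complex.exp (-s * u) =
      LSeries (fun n => (ArithmeticFunction.vonMangoldt n : ℂ)) (s + 1) / (s + 1) := by
  have hs1 : (1:ℝ) < (s+1).re := by simpa using hs
  have hne : s + 1 ≠ 0 := by
    intro h; rw [h] at hs1; simp at hs1; linarith
  have hsum : ∀ n : ℕ, ∑ k ∈ Finset.Icc 1 n, ArithmeticFunction.vonMangoldt k = ψ n := by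
    intro n
    rw [psi, Nat.floor_natCast]
    rfl
  have hO : (fun n : ℕ ↦ ∑ k ∈ Finset.Icc 1 n, ArithmeticFunction.vonMangoldt k) =O[atTop]
      fun n ↦ (n : ℝ) ^ (1:ℝ) := by
    simp_rw [hsum, Real.rpow_one]
    apply Asymptotics.IsBigO.of_bound (Real.log 4 + 4)
    filter_upwards with n
    rw [Real.norm_of_nonneg (psi_nonneg _), Real.norm_of_nonneg (Nat.cast_nonneg n)]
    exact psi_le_const_mul_self (Nat.cast_nonneg n)
  have key := LSeries_eq_mul_integral_of_nonneg (fun n => ArithmeticFunction.vonMangoldt n)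
    zero_le_one hs1 hO (fun n => ArithmeticFunction.vonMangoldt_nonneg)
  rw [key, mul_div_cancel_left₀ _ hne]
  have himg : Real.exp '' (Ioi 0) = Ioi 1 := by
    ext x
    constructor
    · rintro ⟨u, hu, rfl⟩
      exact Real.one_lt_exp_iff.mpr hu
    · intro hx
      have hx' : (1:ℝ) < x := hx
      exact ⟨Real.log x, Real.log_pos hx, Real.exp_log (by linarith)⟩
  rw [← himg, integral_image_eq_integral_abs_deriv_smul measurableSet_Ioi
    (fun x _ => (Real.hasDerivAt_exp x).hasDerivWithinAt) (Real.exp_injective.injOn)]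
  congr 1
  ext u
  have h1 : (∑ k ∈ Finset.Icc 1 ⌊Real.exp u⌋₊, ((ArithmeticFunction.vonMangoldt k : ℝ):ℂ)) =
      (ψ (Real.exp u) : ℂ) := by
    rw [psi]; push_cast; rfl
  have h2 : ((Real.exp u : ℝ):ℂ) ^ (-(s + 1 + 1)) = Complex.exp (-(s+1+1) * u) := by
    rw [Complex.cpow_def_of_ne_zero (by exact_mod_cast (Real.exp_pos u).ne'),
      ← Complex.ofReal_log (Real.exp_pos u).le, Real.log_exp]
    congr 1; ring
  rw [h1, h2, abs_of_pos (Real.exp_pos u), Complex.real_smul]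
  push_cast
  have h3 : Complex.exp (u:ℂ) * Complex.exp (-(s+1+1) * u) = Complex.exp (-(u:ℂ)) * Complex.exp (-s * u) := by
    rw [← Complex.exp_add, ← Complex.exp_add]; congr 1; ring
  linear_combination -(ψ (Real.exp u) : ℂ) * h3

noncomputable def hh (u : ℝ) : ℝ := ψ (Real.exp u) * Real.exp (-u) - 1

lemma hh_nn (u : ℝ) : 0 ≤ 1 + hh u := by
  unfold hh
  have := mul_nonneg (psi_nonneg (Real.exp u)) (Real.exp_pos (-u)).le
  linarith

lemma hh_up (u : ℝ) : 1 + hh u ≤ Real.log 4 + 4 := by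
  unfold hh
  have h1 := psi_le_const_mul_self (Real.exp_pos u).le
  have h2 : Real.exp u * Real.exp (-u) = 1 := by rw [← Real.exp_add]; simp
  have h3 := mul_le_mul_of_nonneg_right h1 (Real.exp_pos (-u)).le
  rw [mul_assoc, h2] at h3
  linarith

lemma hh_bd (u : ℝ) : |hh u| ≤ Real.log 4 + 5 := by
  have h1 := hh_nn u
  have h2 := hh_up u
  have h3 : 0 ≤ Real.log 4 := Real.log_nonneg (by norm_num)
  rw [abs_le]; constructor <;> linarith

lemma hh_meas : Measurable hh := by
  unfold hh
  have := psi_mono.measurable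
  fun_prop

lemma hh_laplace (s : ℂ) (hs : 0 < s.re) :
    ∫ u in Ioi (0:ℝ), (hh u : ℂ) * Complex.exp (-s * u) =
     (ArithmeticFunction.vonMangoldt.LFunctionResidueClassAux (q := 1) 1 (s + 1) - 1) / (s + 1) := by
  have hs1 : (1:ℝ) < (s+1).re := by simpa using hs
  have hne : s + 1 ≠ 0 := by
    intro h; rw [h] at hs1; simp at hs1; linarith
  have hs0 : s ≠ 0 := by
    intro h; rw [h] at hs; simp at hs
  have h1 := ArithmeticFunction.vonMangoldt.eqOn_LFunctionResidueClassAux (q := 1) (a := 1)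
    isUnit_one hs1
  have h2 : (fun n => ((ArithmeticFunction.vonMangoldt.residueClass (q := 1) 1 n : ℝ) : ℂ)) =
      (fun n => (ArithmeticFunction.vonMangoldt n : ℂ)) := by
    ext n
    rw [ArithmeticFunction.vonMangoldt.residueClass, indicator_of_mem]
    exact Subsingleton.elim _ _
  rw [h1, h2]
  have hexp : IntegrableOn (fun u : ℝ => Complex.exp (-s * u)) (Ioi 0) :=
    integrableOn_exp_mul_complex_Ioi (by simpa using hs) 0
  have e1 : ∀ u : ℝ, (hh u : ℂ) * Complex.exp (-s * u) =
      (ψ (Real.exp u) * Real.exp (-u) : ℂ) * Complex.exp (-s * u) - Complex.exp (-s * u) := by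
    intro u; unfold hh; push_cast; ring
  simp_rw [e1]
  rw [integral_sub _ hexp, psi_laplace s hs, integral_exp_mul_complex_Ioi (by simpa using hs) 0]
  · simp
    field_simp
    ring
  · refine Integrable.mono' (hexp.norm.const_mul (Real.log 4 + 4)) ?_ ?_
    · apply Measurable.aestronglyMeasurable
      have := psi_mono.measurable
      fun_prop
    · filter_upwards with u
      rw [norm_mul]
      gcongr
      have h3 := hh_nn u
      have h4 := hh_up u
      rw [← Complex.ofReal_mul, Complex.norm_real, Real.norm_eq_abs]
      unfold hh at h3 h4
      rw [abs_of_nonneg (by linarith)]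
      linarith

theorem psi_tendsto : Tendsto (fun x : ℝ => ψ x / x) atTop (𝓝 1) := by
  have h := tauberian hh hh_meas _ hh_bd
    (fun s => (ArithmeticFunction.vonMangoldt.LFunctionResidueClassAux (q := 1) 1 (s + 1) - 1) / (s + 1))
    ?_ hh_laplace ?_ hh_nn
  · have h1 := h.comp Real.tendsto_log_atTop
    have h2 := h1.const_add 1
    rw [add_zero] at h2
    refine h2.congr' ?_
    filter_upwards [eventually_gt_atTop 0] with x hx
    simp only [Function.comp, hh]
    rw [Real.exp_neg, Real.exp_log hx, div_eq_mul_inv]; ring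
  · refine ContinuousOn.div (ContinuousOn.sub ?_ continuousOn_const) (by fun_prop) ?_
    · refine (ArithmeticFunction.vonMangoldt.continuousOn_LFunctionResidueClassAux
        (q := 1) 1).comp (by fun_prop) ?_
      intro s hs
      simpa using hs
    · intro s hs h
      have : (s+1).re = 0 := by rw [h]; simp
      simp at this hs
      linarith
  · intro u v huv
    have e : ∀ u, Real.exp u * (1 + hh u) = ψ (Real.exp u) := by
      intro u; unfold hh
      have h2 : Real.exp u * Real.exp (-u) = 1 := by rw [← Real.exp_add]; simp
      linear_combination ψ (Real.exp u) * h2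
    rw [e, e]
    exact psi_mono (Real.exp_le_exp.mpr huv)

theorem theta_tendsto : Tendsto (fun n : ℕ => θ n / n) atTop (𝓝 1) := by
  have h1 : Tendsto (fun x : ℝ => 2 * (Real.log x / x ^ (1/2:ℝ))) atTop (𝓝 0) := by
    have := (isLittleO_log_rpow_atTop (show (0:ℝ) < 1/2 by norm_num)).tendsto_div_nhds_zero
    simpa using this.const_mul 2
  have h2 : Tendsto (fun x : ℝ => θ x / x) atTop (𝓝 1) := by
    have h3 := psi_tendsto.sub h1
    rw [sub_zero] at h3
    refine tendsto_of_tendsto_of_tendsto_of_le_of_le' h3 psi_tendsto ?_ ?_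
    · filter_upwards [eventually_ge_atTop 1] with x hx
      have h4 := psi_sub_theta_le hx
      have hx0 : 0 < x := by linarith
      have hs : 0 < √x := Real.sqrt_pos.mpr hx0
      rw [← Real.sqrt_eq_rpow, sub_le_iff_le_add, div_le_iff₀ hx0]
      have : (θ x / x + 2 * (Real.log x / √x)) * x = θ x + 2 * √x * Real.log x := by
        have h5 : x = √x * √x := (Real.mul_self_sqrt hx0.le).symm
        rw [add_mul, div_mul_cancel₀ _ hx0.ne']
        congr 1
        field_simp
        rw [Real.sq_sqrt hx0.le]
      rw [this]; linarith
    · filter_upwards [eventually_gt_atTop 0] with x hx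
      gcongr
      exact theta_le_psi x
  exact h2.comp tendsto_natCast_atTop_atTop

end LandauPNT

end

section
open Filter Topology Chebyshev

namespace LandauPNT

noncomputable def W (N : ℕ) : ℝ := ∑ p ∈ Nat.primesLE N, Real.log p * (1 - p / N)

noncomputable def P (N : ℕ) : ℕ := ∑ p ∈ Nat.primesLE N, p

lemma sum_theta (N : ℕ) :
    ∑ m ∈ Finset.range N, θ m = ∑ p ∈ Nat.primesLE N, Real.log p * (N - p) := by
  simp_rw [theta_eq_sum_primesLE_log, Nat.primesLE_eq_filter_range, Finset.sum_filter]
  induction N with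
  | zero => simp
  | succ N ih =>
    rw [Finset.sum_range_succ, ih, Finset.sum_range_succ _ (N+1), ← Finset.sum_add_distrib]
    simp only [sub_self, mul_zero, ite_self, add_zero]
    apply Finset.sum_congr rfl
    intro p _
    split_ifs
    · push_cast; ring
    · simp

lemma W_eq (N : ℕ) (hN : 0 < N) : W N = (∑ m ∈ Finset.range N, θ m) / N := by
  rw [sum_theta, W, Finset.sum_div]
  apply Finset.sum_congr rfl
  intro p _
  have : (N:ℝ) ≠ 0 := by positivity
  field_simp

lemma sum_id (N : ℕ) : ∑ m ∈ Finset.range N, (m:ℝ) = N * (N - 1) / 2 := by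
  induction N with
  | zero => simp
  | succ N ih => rw [Finset.sum_range_succ, ih]; push_cast; ring

lemma inv_tendsto : Tendsto (fun N : ℕ => (N:ℝ)⁻¹) atTop (𝓝 0) :=
  tendsto_inv_atTop_zero.comp tendsto_natCast_atTop_atTop

lemma W_tendsto : Tendsto (fun N : ℕ => W N / N) atTop (𝓝 (1/2)) := by
  have h1 : (fun m : ℕ => θ m - m) =o[atTop] (fun m : ℕ => (m:ℝ)) := by
    rw [Asymptotics.isLittleO_iff_tendsto']
    · have := theta_tendsto.sub_const 1
      rw [sub_self] at this
      refine this.congr' ?_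
      filter_upwards [eventually_gt_atTop 0] with n hn
      have : (n:ℝ) ≠ 0 := by positivity
      field_simp
    · filter_upwards [eventually_gt_atTop 0] with n hn h
      have : (n:ℝ) ≠ 0 := by positivity
      exact absurd h this
  have hS : Tendsto (fun N : ℕ => (∑ m ∈ Finset.range N, (m:ℝ)) / (N:ℝ)^2) atTop (𝓝 (1/2)) := by
    have := (inv_tendsto.const_sub 1).div_const 2
    rw [sub_zero] at this
    refine this.congr' ?_
    filter_upwards [eventually_gt_atTop 0] with n hn
    have : (n:ℝ) ≠ 0 := by positivity
    rw [sum_id]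
    field_simp
  have h2 := h1.sum_range (fun m => Nat.cast_nonneg m) (by
    simp_rw [sum_id]
    have a1 : Tendsto (fun N : ℕ => (N:ℝ)) atTop atTop := tendsto_natCast_atTop_atTop
    have a2 : Tendsto (fun N : ℕ => (N:ℝ) - 1) atTop atTop := tendsto_atTop_add_const_right _ _ a1
    exact (a1.atTop_mul_atTop₀ a2).atTop_div_const (by norm_num))
  have h3 := (h2.tendsto_div_nhds_zero.mul hS).add hS
  rw [zero_mul, zero_add] at h3
  refine h3.congr' ?_
  filter_upwards [eventually_gt_atTop 1] with n hn
  rw [W_eq n (by omega), Finset.sum_sub_distrib]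
  have : (n:ℝ) ≠ 0 := by positivity
  have h4 : ∑ m ∈ Finset.range n, (m:ℝ) ≠ 0 := by
    rw [sum_id]
    have : (1:ℝ) < n := by exact_mod_cast hn
    have : 0 < (n:ℝ) * (n - 1) / 2 := by
      have : 0 < (n:ℝ) - 1 := by linarith
      positivity
    exact this.ne'
  field_simp
  ring

lemma Q_tendsto : Tendsto (fun N : ℕ => (∑ p ∈ Nat.primesLE N, Real.log p * p) / (N:ℝ)^2) atTop
    (𝓝 (1/2)) := by
  have := theta_tendsto.sub W_tendsto
  rw [show (1:ℝ) - 1/2 = 1/2 by norm_num] at this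
  refine this.congr' ?_
  filter_upwards [eventually_gt_atTop 0] with n hn
  have hn' : (n:ℝ) ≠ 0 := by positivity
  rw [theta_eq_sum_primesLE_log, W, ← sub_div, ← Finset.sum_sub_distrib, Finset.sum_div, Finset.sum_div]
  apply Finset.sum_congr rfl
  intro p _
  field_simp
  ring

lemma P_le (N : ℕ) (y : ℝ) (hy : 1 < y) :
    (P N : ℝ) ≤ y^2 + (∑ p ∈ Nat.primesLE N, Real.log p * p) / Real.log y := by
  have hly := Real.log_pos hy
  unfold P
  push_cast
  rw [← Finset.sum_filter_add_sum_filter_not _ (fun p : ℕ => (p:ℝ) ≤ y)]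
  apply add_le_add
  · have hcard : ((Finset.filter (fun p : ℕ => (p:ℝ) ≤ y) (Nat.primesLE N)).card : ℝ) ≤ y := by
      have : (Finset.filter (fun p : ℕ => (p:ℝ) ≤ y) (Nat.primesLE N)) ⊆ Finset.Icc 1 ⌊y⌋₊ := by
        intro p hp
        rw [Finset.mem_filter, Nat.mem_primesLE] at hp
        rw [Finset.mem_Icc]
        exact ⟨hp.1.2.one_lt.le, Nat.le_floor hp.2⟩
      have h := Finset.card_le_card this
      rw [Nat.card_Icc, Nat.add_sub_cancel] at h
      calc _ ≤ (⌊y⌋₊ : ℝ) := by exact_mod_cast h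
        _ ≤ y := Nat.floor_le (by linarith)
    calc _ ≤ (Finset.filter (fun p : ℕ => (p:ℝ) ≤ y) (Nat.primesLE N)).card • y := by
          apply Finset.sum_le_card_nsmul
          intro p hp
          exact (Finset.mem_filter.mp hp).2
      _ ≤ y^2 := by
          rw [nsmul_eq_mul, sq]; gcongr
  · rw [Finset.sum_div]
    calc _ ≤ ∑ p ∈ Finset.filter (fun p : ℕ => ¬ (p:ℝ) ≤ y) (Nat.primesLE N),
          Real.log p * p / Real.log y := by
          apply Finset.sum_le_sum
          intro p hp
          have hp := (Finset.mem_filter.mp hp).2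
          push Not at hp
          rw [le_div_iff₀ hly, mul_comm]
          gcongr
      _ ≤ _ := by
          apply Finset.sum_le_sum_of_subset_of_nonneg (Finset.filter_subset _ _)
          intro p _ _
          have : 0 ≤ Real.log p := Real.log_natCast_nonneg p
          positivity

lemma P_eventually (c : ℝ) (hc : 1/2 < c) :
    ∀ᶠ N : ℕ in atTop, (P N : ℝ) ≤ c * (N^2 / Real.log N) := by
  have hlog : Tendsto (fun N : ℕ => Real.log N) atTop atTop :=
    Real.tendsto_log_atTop.comp tendsto_natCast_atTop_atTop
  have h1 : Tendsto (fun N : ℕ => Real.log (Real.log N) / Real.log N) atTop (𝓝 0) :=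
    Real.isLittleO_log_id_atTop.tendsto_div_nhds_zero.comp hlog
  have h2 : Tendsto (fun N : ℕ => (Real.log N)⁻¹) atTop (𝓝 0) := tendsto_inv_atTop_zero.comp hlog
  have h3 := h2.add (Q_tendsto.div (h1.const_sub 1) (by norm_num))
  rw [zero_add, sub_zero, div_one] at h3
  have h4 : Tendsto (fun N : ℕ => Real.log N / (N:ℝ)) atTop (𝓝 0) :=
    Real.isLittleO_log_id_atTop.tendsto_div_nhds_zero.comp tendsto_natCast_atTop_atTop
  filter_upwards [h3.eventually_lt_const hc, h4.eventually_lt_const zero_lt_one,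
    hlog.eventually_gt_atTop 1, eventually_gt_atTop 0] with N hN h4N hl hN0
  have hN' : (0:ℝ) < N := by positivity
  have hl0 : 0 < Real.log N := by linarith
  rw [div_lt_one hN'] at h4N
  have hy : 1 < (N:ℝ) / Real.log N := by rwa [one_lt_div hl0]
  refine (P_le N _ hy).trans ?_
  have hly := Real.log_pos hy
  rw [Real.log_div hN'.ne' hl0.ne'] at hly ⊢
  have hmul := mul_le_mul_of_nonneg_right hN.le (show 0 ≤ (N:ℝ)^2 / Real.log N by positivity)
  refine le_trans (le_of_eq ?_) hmul
  have : 1 - Real.log (Real.log N) / Real.log N = (Real.log N - Real.log (Real.log N)) / Real.log N := by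
    field_simp
  simp only [Pi.div_apply]
  rw [this]
  have := hly.ne'
  field_simp

end LandauPNT

end

namespace IterMap

theorem T_le_orderOf {n : ℕ} (f : Fin n → Fin n) : T f ≤ orderOf (cyclicPerm f) := by
  apply Nat.sInf_le
  refine ⟨orderOf_pos _, ?_⟩
  intro m hm
  have hcyc : ∀ v, IsCyclic f (f^[m] v) := by
    intro v
    obtain ⟨i, j, hij, he⟩ := Fintype.exists_ne_map_eq_of_card_lt
      (fun i : Fin (n+1) => f^[(i:ℕ)] v) (by simp)
    wlog hlt : i < j generalizing i j
    · exact this j i hij.symm he.symm (lt_of_le_of_ne (not_lt.mp hlt) hij.symm)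
    have hlt' : (i:ℕ) < j := hlt
    change f^[(i:ℕ)] v = f^[(j:ℕ)] v at he
    refine ⟨j - i, by omega, ?_⟩
    have hi : (i:ℕ) ≤ m := by have := i.2; omega
    rw [← Function.iterate_add_apply, show (j:ℕ) - i + m = (m - i) + j by omega,
      Function.iterate_add_apply, ← he, ← Function.iterate_add_apply, Nat.sub_add_cancel hi]
  have hit : ∀ (k : ℕ) (v : {v : Fin n // IsCyclic f v}), (((cyclicPerm f)^k) v).1 = f^[k] v.1 := by
    intro k
    induction k with
    | zero => intro v; simp
    | succ k ih =>
      intro v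
      rw [pow_succ', Equiv.Perm.mul_apply, Function.iterate_succ_apply', ← ih]
      rfl
  funext v
  rw [add_comm, Function.iterate_add_apply]
  have := hit (orderOf (cyclicPerm f)) ⟨f^[m] v, hcyc v⟩
  rw [pow_orderOf_eq_one] at this
  exact this.symm

theorem T_perm {n : ℕ} (σ : Equiv.Perm (Fin n)) : orderOf σ ≤ T (σ : Fin n → Fin n) := by
  have hne : {T : ℕ | 0 < T ∧ ∀ m, n ≤ m → (σ : Fin n → Fin n)^[m + T] = (σ : Fin n → Fin n)^[m]}.Nonempty := by
    refine ⟨orderOf σ, orderOf_pos σ, ?_⟩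
    intro m _
    rw [← Equiv.Perm.coe_pow, ← Equiv.Perm.coe_pow, pow_add, pow_orderOf_eq_one, mul_one]
  obtain ⟨h1, h2⟩ := Nat.sInf_mem hne
  have h3 := h2 n le_rfl
  rw [← Equiv.Perm.coe_pow, ← Equiv.Perm.coe_pow, pow_add] at h3
  have h4 := DFunLike.coe_injective h3
  rw [mul_eq_left] at h4
  exact orderOf_le_of_pow_eq_one h1 h4

open LandauPNT Chebyshev in
theorem lowerT (n N : ℕ) (h : P N ≤ n) : ∃ f : Fin n → Fin n, θ N ≤ Real.log (T f) := by
  have hex : ∃ σ : Equiv.Perm (Fin n), σ.cycleType = (Nat.primesLE N).val := by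
    rw [Equiv.Perm.exists_with_cycleType_iff]
    constructor
    · rw [Fintype.card_fin]
      refine le_trans (le_of_eq ?_) h
      exact (Finset.sum_val (Nat.primesLE N))
    · intro a ha
      exact (Nat.two_le_of_mem_primesLE ha)
  obtain ⟨σ, hσ⟩ := hex
  refine ⟨σ, ?_⟩
  have h1 : (primorial N) ∣ orderOf σ := by
    rw [← Equiv.Perm.lcm_cycleType, hσ, primorial_eq_prod_primesLE]
    apply Finset.prod_primes_dvd
    · intro p hp; exact (Nat.prime_of_mem_primesLE hp).prime
    · intro p hp
      exact Multiset.dvd_lcm hp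
  have h2 : primorial N ≤ T (σ : Fin n → Fin n) :=
    (Nat.le_of_dvd (orderOf_pos σ) h1).trans (T_perm σ)
  rw [theta_eq_log_primorial, Nat.floor_natCast]
  apply Real.log_le_log
  · exact_mod_cast primorial_pos N
  · exact_mod_cast h2

/-- the sum of the maximal prime powers dividing `k` -/
def hsum (k : ℕ) : ℕ := ∑ p ∈ k.primeFactors, p ^ (k.factorization p)

theorem sum_le_prod_aux (s : Finset ℕ) (q : ℕ → ℕ) (hq : ∀ p ∈ s, 2 ≤ q p) :
    ∑ p ∈ s, q p ≤ ∏ p ∈ s, q p := by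
  induction s using Finset.induction_on with
  | empty => simp
  | insert a s ha ih =>
    rw [Finset.sum_insert ha, Finset.prod_insert ha]
    have h1 := ih (fun p hp => hq p (Finset.mem_insert_of_mem hp))
    have h2 := hq a (Finset.mem_insert_self _ _)
    rcases s.eq_empty_or_nonempty with rfl | ⟨b, hb⟩
    · simp
    · have h3 : 2 ≤ ∑ p ∈ s, q p := (hq b (Finset.mem_insert_of_mem hb)).trans
        (Finset.single_le_sum (f := q) (fun _ _ => Nat.zero_le _) hb)
      nlinarith

theorem hsum_le {a : ℕ} (ha : a ≠ 0) : hsum a ≤ a := by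
  calc hsum a ≤ ∏ p ∈ a.primeFactors, p ^ (a.factorization p) := by
        apply sum_le_prod_aux
        intro p hp
        have h1 := (Nat.prime_of_mem_primeFactors hp).two_le
        have h2 : a.factorization p ≠ 0 := by
          rw [← Finsupp.mem_support_iff, Nat.support_factorization]; exact hp
        exact h1.trans (Nat.le_self_pow h2 p)
    _ = a := Nat.prod_factorization_pow_eq_self ha

theorem hsum_lcm {a b : ℕ} (ha : a ≠ 0) (hb : b ≠ 0) : hsum (Nat.lcm a b) ≤ hsum a + hsum b := by
  unfold hsum
  rw [Nat.factorization_lcm ha hb]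
  have hpf : (Nat.lcm a b).primeFactors = a.primeFactors ∪ b.primeFactors := by
    ext p
    simp only [Nat.mem_primeFactors, Finset.mem_union, Nat.lcm_ne_zero ha hb, ne_eq, ha, hb,
      not_false_eq_true, and_true]
    constructor
    · rintro ⟨hp, hd⟩
      rcases (hp.dvd_lcm).mp hd with h | h
      · exact Or.inl ⟨hp, h⟩
      · exact Or.inr ⟨hp, h⟩
    · rintro (⟨hp, h⟩ | ⟨hp, h⟩)
      · exact ⟨hp, h.trans (Nat.dvd_lcm_left a b)⟩
      · exact ⟨hp, h.trans (Nat.dvd_lcm_right a b)⟩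
  rw [hpf]
  have key : ∀ p ∈ a.primeFactors ∪ b.primeFactors, p ^ ((a.factorization ⊔ b.factorization) p) ≤
      (if p ∈ a.primeFactors then p ^ a.factorization p else 0) +
      (if p ∈ b.primeFactors then p ^ b.factorization p else 0) := by
    intro p hp
    have h1 : (a.factorization ⊔ b.factorization) p = max (a.factorization p) (b.factorization p) := rfl
    rw [h1]
    by_cases hpa : p ∈ a.primeFactors <;> by_cases hpb : p ∈ b.primeFactors
    · rw [if_pos hpa, if_pos hpb]
      rcases max_choice (a.factorization p) (b.factorization p) with h | h <;> rw [h] <;> omega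
    · rw [if_pos hpa, if_neg hpb]
      have : b.factorization p = 0 := by
        rwa [← Finsupp.notMem_support_iff, Nat.support_factorization]
      simp [this]
    · rw [if_neg hpa, if_pos hpb]
      have : a.factorization p = 0 := by
        rwa [← Finsupp.notMem_support_iff, Nat.support_factorization]
      simp [this]
    · rw [Finset.mem_union] at hp; tauto
  refine (Finset.sum_le_sum key).trans ?_
  rw [Finset.sum_add_distrib, ← Finset.sum_filter, ← Finset.sum_filter]
  apply le_of_eq
  congr 2
  · ext p; simp only [Finset.mem_filter, Finset.mem_union]; tauto
  · ext p; simp only [Finset.mem_filter, Finset.mem_union]; tauto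

theorem hsum_multiset (m : Multiset ℕ) (hm : ∀ a ∈ m, a ≠ 0) : m.lcm ≠ 0 ∧ hsum m.lcm ≤ m.sum := by
  induction m using Multiset.induction_on with
  | empty => simp [hsum]
  | cons a m ih =>
    have h1 := ih (fun b hb => hm b (Multiset.mem_cons_of_mem hb))
    have h2 := hm a (Multiset.mem_cons_self _ _)
    rw [Multiset.lcm_cons, Multiset.sum_cons, lcm_eq_nat_lcm]
    exact ⟨Nat.lcm_ne_zero h2 h1.1, (hsum_lcm h2 h1.1).trans (add_le_add (hsum_le h2) h1.2)⟩

theorem log_eq_sum {k : ℕ} (hk : k ≠ 0) :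
    Real.log k = ∑ p ∈ k.primeFactors, Real.log ((p ^ (k.factorization p) : ℕ) : ℝ) := by
  rw [← Real.log_prod]
  · congr 1
    have := Nat.prod_factorization_pow_eq_self hk
    conv_lhs => rw [← this]
    rw [Finsupp.prod, Nat.support_factorization]
    push_cast; rfl
  · intro p hp
    have := (Nat.prime_of_mem_primeFactors hp).pos
    positivity

open LandauPNT in
theorem log_bound (n N k : ℕ) (hN : 3 ≤ N) (hk : k ≠ 0) (hkn : hsum k ≤ n) :
    Real.log k ≤ n * (Real.log N / N) + W N + Real.sqrt N * Real.log N := by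
  have hN0 : (0:ℝ) < N := by have : 0 < N := by omega
                             exact_mod_cast this
  have hlN : 0 ≤ Real.log N := Real.log_natCast_nonneg N
  have key : ∀ p ∈ k.primeFactors, Real.log ((p ^ (k.factorization p) : ℕ) : ℝ) ≤
      ((p ^ (k.factorization p) : ℕ) : ℝ) * (Real.log N / N) +
      (if p ≤ N then Real.log p * (1 - p / N) else 0) +
      (if p ^ 2 ≤ N then Real.log N else 0) := by
    intro p hp
    have hpp := Nat.prime_of_mem_primeFactors hp
    have ha : k.factorization p ≠ 0 := by
      rw [← Finsupp.mem_support_iff, Nat.support_factorization]; exact hp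
    have hqpos : 0 < p ^ (k.factorization p) := pow_pos hpp.pos _
    have hpq : p ≤ p ^ (k.factorization p) := Nat.le_self_pow ha p
    have hi1 : 0 ≤ (if p ≤ N then Real.log p * (1 - p / N : ℝ) else 0) := by
      split_ifs with h
      · apply mul_nonneg (Real.log_natCast_nonneg p)
        rw [sub_nonneg, div_le_one hN0]
        exact_mod_cast h
      · exact le_rfl
    have hi2 : 0 ≤ (if p ^ 2 ≤ N then Real.log N else 0) := by split_ifs <;> [exact hlN; exact le_rfl]
    by_cases ha1 : k.factorization p = 1
    · rw [ha1, pow_one] at *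
      by_cases hpN : p ≤ N
      · rw [if_pos hpN] at *
        have h1 : Real.log p ≤ Real.log N := by
          apply Real.log_le_log; exact_mod_cast hpp.pos
          exact_mod_cast hpN
        have h2 : (p:ℝ) * (Real.log N / N) + Real.log p * (1 - p / N) =
          Real.log p + (p / N) * (Real.log N - Real.log p) := by ring
        have h3 : 0 ≤ ((p:ℝ) / N) * (Real.log N - Real.log p) :=
          mul_nonneg (by positivity) (by linarith)
        linarith
      · have hlt : (N:ℝ) ≤ p := by exact_mod_cast (by omega : N ≤ p)
        have := Real.log_div_self_antitoneOn (a := (N:ℝ)) (b := p) ?_ ?_ hlt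
        · have hp0 : (0:ℝ) < p := by linarith
          simp only at this
          rw [div_le_iff₀ hp0] at this
          nlinarith
        · have : (3:ℝ) ≤ N := by exact_mod_cast hN
          change Real.exp 1 ≤ _; linarith [Real.exp_one_lt_d9]
        · have : (3:ℝ) ≤ N := by exact_mod_cast hN
          change Real.exp 1 ≤ _; linarith [Real.exp_one_lt_d9]
    · have ha2 : 2 ≤ k.factorization p := by omega
      set q := p ^ (k.factorization p) with hq
      have hp2 : p ^ 2 ≤ q := Nat.pow_le_pow_right hpp.pos ha2
      by_cases hqN : q ≤ N
      · have h1 : Real.log q ≤ Real.log N := by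
          apply Real.log_le_log; exact_mod_cast hqpos
          exact_mod_cast hqN
        rw [if_pos (hp2.trans hqN)]
        have : 0 ≤ (q:ℝ) * (Real.log N / N) := by positivity
        linarith
      · have hlt : (N:ℝ) ≤ q := by exact_mod_cast (by omega : N ≤ q)
        have := Real.log_div_self_antitoneOn (a := (N:ℝ)) (b := q) ?_ ?_ hlt
        · have hp0 : (0:ℝ) < q := by linarith
          simp only at this
          rw [div_le_iff₀ hp0] at this
          nlinarith
        · have : (3:ℝ) ≤ N := by exact_mod_cast hN
          change Real.exp 1 ≤ _; linarith [Real.exp_one_lt_d9]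
        · have : (3:ℝ) ≤ N := by exact_mod_cast hN
          change Real.exp 1 ≤ _; linarith [Real.exp_one_lt_d9]
  rw [log_eq_sum hk]
  refine (Finset.sum_le_sum key).trans ?_
  rw [Finset.sum_add_distrib, Finset.sum_add_distrib, ← Finset.sum_mul]
  apply add_le_add (add_le_add _ _) _
  · gcongr
    have : ((hsum k : ℕ) : ℝ) ≤ n := by exact_mod_cast hkn
    rw [hsum] at this
    push_cast at this ⊢
    exact this
  · rw [← Finset.sum_filter, W]
    apply Finset.sum_le_sum_of_subset_of_nonneg
    · intro p hp
      rw [Finset.mem_filter] at hp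
      rw [Nat.mem_primesLE]
      exact ⟨hp.2, Nat.prime_of_mem_primeFactors hp.1⟩
    · intro p hp _
      apply mul_nonneg (Real.log_natCast_nonneg p)
      rw [sub_nonneg, div_le_one hN0]
      exact_mod_cast Nat.le_of_mem_primesLE hp
  · rw [← Finset.sum_filter, Finset.sum_const, nsmul_eq_mul]
    gcongr
    have h1 : (Finset.filter (fun p => p ^ 2 ≤ N) k.primeFactors) ⊆ Finset.Icc 1 (Nat.sqrt N) := by
      intro p hp
      rw [Finset.mem_filter] at hp
      rw [Finset.mem_Icc]
      exact ⟨(Nat.prime_of_mem_primeFactors hp.1).pos, Nat.le_sqrt'.mpr hp.2⟩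
    have h2 := Finset.card_le_card h1
    rw [Nat.card_Icc, Nat.add_sub_cancel] at h2
    calc _ ≤ ((Nat.sqrt N : ℕ) : ℝ) := by exact_mod_cast h2
      _ ≤ Real.sqrt N := Real.nat_sqrt_le_real_sqrt

open LandauPNT in
theorem upperT (n N : ℕ) (hN : 3 ≤ N) (f : Fin n → Fin n) :
    Real.log (T f) ≤ n * (Real.log N / N) + W N + Real.sqrt N * Real.log N := by
  have h1 := hsum_multiset (cyclicPerm f).cycleType (fun a ha => by
    have := Equiv.Perm.two_le_of_mem_cycleType ha; omega)
  rw [Equiv.Perm.lcm_cycleType] at h1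
  have h2 : (cyclicPerm f).cycleType.sum ≤ n := by
    refine (Equiv.Perm.sum_cycleType_le _).trans ?_
    refine (Fintype.card_subtype_le _).trans ?_
    simp
  have h3 := log_bound n N _ hN h1.1 (h1.2.trans h2)
  refine le_trans ?_ h3
  rcases Nat.eq_zero_or_pos (T f) with h0 | h0
  · rw [h0]; simp only [Nat.cast_zero, Real.log_zero]; exact Real.log_natCast_nonneg _
  · apply Real.log_le_log
    · exact_mod_cast h0
    · exact_mod_cast T_le_orderOf f

end IterMap

namespace IterMap

open Filter Topology LandauPNT Chebyshev

noncomputable def X (n : ℕ) : ℝ := Real.sqrt ((n : ℝ) * Real.log n)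

lemma log_nat_tendsto : Tendsto (fun n : ℕ => Real.log n) atTop atTop :=
  Real.tendsto_log_atTop.comp tendsto_natCast_atTop_atTop

lemma X_tendsto : Tendsto X atTop atTop := by
  apply Real.tendsto_sqrt_atTop.comp
  exact Tendsto.atTop_mul_atTop₀ tendsto_natCast_atTop_atTop log_nat_tendsto

lemma X_sq (n : ℕ) : X n ^ 2 = n * Real.log n :=
  Real.sq_sqrt (mul_nonneg (by positivity) (Real.log_natCast_nonneg n))

lemma floor_tendsto (c : ℝ) (hc : 0 < c) :
    Tendsto (fun n : ℕ => (⌊c * X n⌋₊ : ℝ) / X n) atTop (𝓝 c) :=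
  (tendsto_nat_floor_mul_div_atTop hc.le).comp X_tendsto

lemma floor_atTop (c : ℝ) (hc : 0 < c) : Tendsto (fun n : ℕ => ⌊c * X n⌋₊) atTop atTop :=
  tendsto_nat_floor_atTop.comp (X_tendsto.const_mul_atTop hc)

lemma logX_tendsto : Tendsto (fun n : ℕ => Real.log (X n) / Real.log n) atTop (𝓝 (1/2)) := by
  have h1 : Tendsto (fun y : ℝ => Real.log y / y) atTop (𝓝 0) :=
    Real.isLittleO_log_id_atTop.tendsto_div_nhds_zero
  have h2 := h1.comp log_nat_tendsto
  have h3 := (h2.const_add 1).div_const 2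
  rw [add_zero] at h3
  refine h3.congr' ?_
  filter_upwards [eventually_ge_atTop 1, log_nat_tendsto.eventually_gt_atTop 0] with n hn hl
  have hn0 : (n:ℝ) ≠ 0 := by positivity
  rw [X, Real.log_sqrt (by positivity), Real.log_mul hn0 hl.ne']
  simp only [Function.comp]
  field_simp

lemma upper_ev (b : ℝ) (hb : 1 < b) : ∀ᶠ n : ℕ in atTop,
    Real.log ((Finset.univ.sup fun f : Fin n → Fin n => T f : ℕ) : ℝ) / X n < b := by
  have hN := floor_atTop 1 one_pos
  have hq := floor_tendsto 1 one_pos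
  have hl : Tendsto (fun y : ℝ => Real.log y / Real.sqrt y) atTop (𝓝 0) := by
    have := (isLittleO_log_rpow_atTop (r := 1/2) (by norm_num)).tendsto_div_nhds_zero
    simpa only [Real.sqrt_eq_rpow] using this
  have hl' := (hl.comp tendsto_natCast_atTop_atTop).comp hN
  have hW := W_tendsto.comp hN
  have hU := ((logX_tendsto.mul (hq.inv₀ one_ne_zero)).add (hW.mul hq)).add (hl'.mul hq)
  have e : (1/2 * (1:ℝ)⁻¹ + 1/2 * 1 + 0 * 1) = 1 := by norm_num
  rw [e] at hU
  filter_upwards [hU.eventually_lt_const hb, hN.eventually_ge_atTop 3, eventually_ge_atTop 2,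
    X_tendsto.eventually_gt_atTop 0] with n h1 h3 hn hX
  refine lt_of_le_of_lt ?_ h1
  have : Nonempty (Fin n) := ⟨⟨0, by omega⟩⟩
  obtain ⟨f, -, hf⟩ := Finset.exists_mem_eq_sup (Finset.univ : Finset (Fin n → Fin n))
    Finset.univ_nonempty (fun f => T f)
  rw [hf]
  have hu := upperT n _ h3 f
  have hfl : (⌊1 * X n⌋₊ : ℝ) ≤ X n := by
    have := Nat.floor_le (a := 1 * X n) (by positivity)
    linarith
  simp only [Function.comp]
  set N := ⌊1 * X n⌋₊ with hNdef
  have hN0 : (0:ℝ) < N := by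
    have : (3:ℝ) ≤ N := by exact_mod_cast h3
    linarith
  have hlog : Real.log N ≤ Real.log (X n) := Real.log_le_log hN0 hfl
  have hln : 0 < Real.log n := Real.log_pos (by exact_mod_cast hn)
  have hsN : 0 < Real.sqrt N := Real.sqrt_pos.2 hN0
  have hss : Real.sqrt N * Real.sqrt N = N := Real.mul_self_sqrt hN0.le
  have hsq := X_sq n
  rw [div_le_iff₀ hX]
  refine hu.trans ?_
  have e1 : (Real.log (X n) / Real.log n * ((N:ℝ) / X n)⁻¹ + W N / N * (N / X n) +
      Real.log N / Real.sqrt N * (N / X n)) * X n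
      = n * (Real.log (X n) / N) + W N + Real.sqrt N * Real.log N := by
    have a1 : Real.log (X n) / Real.log n * ((N:ℝ) / X n)⁻¹ * X n = n * (Real.log (X n) / N) := by
      field_simp
      rw [hsq]; ring
    have a2 : W N / N * (N / X n) * X n = W N := by field_simp
    have a3 : Real.log N / Real.sqrt N * (N / X n) * X n = Real.sqrt N * Real.log N := by
      field_simp
      rw [sq, hss]
    rw [add_mul, add_mul, a1, a2, a3]
  rw [e1]
  gcongr

lemma lower_ev (a : ℝ) (ha : a < 1) : ∀ᶠ n : ℕ in atTop,
    a < Real.log ((Finset.univ.sup fun f : Fin n → Fin n => T f : ℕ) : ℝ) / X n := by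
  obtain ⟨c, hac, hc1⟩ := exists_between (max_lt ha one_pos)
  have hac' : a < c := (le_max_left _ _).trans_lt hac
  have hc0 : 0 < c := (le_max_right _ _).trans_lt hac
  have hN := floor_atTop c hc0
  have hq := floor_tendsto c hc0
  have hθ := (theta_tendsto.comp hN).mul hq
  rw [one_mul] at hθ
  have hcc : 1/2 < 1 / (2 * c^2) := by
    apply one_div_lt_one_div_of_lt (by positivity)
    nlinarith
  have hP := hN.eventually (P_eventually _ hcc)
  have hbig : Tendsto (fun n : ℕ => (⌊c * X n⌋₊ : ℝ) / X n * Real.sqrt (Real.log n)) atTop atTop :=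
    hq.pos_mul_atTop hc0 (Real.tendsto_sqrt_atTop.comp log_nat_tendsto)
  filter_upwards [hθ.eventually_const_lt hac', hN.eventually_ge_atTop 3, eventually_ge_atTop 2,
    X_tendsto.eventually_gt_atTop 0, hP, hbig.eventually_ge_atTop 1] with n h1 h3 hn hX hP hb
  refine lt_of_lt_of_le h1 ?_
  simp only [Function.comp]
  have hfl : (⌊c * X n⌋₊ : ℝ) ≤ c * X n := Nat.floor_le (by positivity)
  set N := ⌊c * X n⌋₊ with hNdef
  have hN0 : (0:ℝ) < N := by
    have : (3:ℝ) ≤ N := by exact_mod_cast h3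
    linarith
  have hln : 0 < Real.log n := Real.log_pos (by exact_mod_cast hn)
  have hsq := X_sq n
  have hn0 : (0:ℝ) < n := by positivity
  have hX2 : X n = Real.sqrt n * Real.sqrt (Real.log n) := Real.sqrt_mul hn0.le _
  have hNn : Real.sqrt n ≤ N := by
    have : (N:ℝ) / X n * Real.sqrt (Real.log n) = N / Real.sqrt n := by
      have : Real.sqrt (Real.log n) ≠ 0 := (Real.sqrt_pos.2 hln).ne'
      rw [hX2]; field_simp
    rw [this, one_le_div (Real.sqrt_pos.2 hn0)] at hb
    exact hb
  have hlogN : Real.log n / 2 ≤ Real.log N := by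
    rw [← Real.log_sqrt hn0.le]
    exact Real.log_le_log (Real.sqrt_pos.2 hn0) hNn
  have hPn : (P N : ℝ) ≤ n := by
    refine hP.trans ?_
    have b1 : (N:ℝ)^2 ≤ c^2 * (n * Real.log n) := by
      rw [← hsq, ← mul_pow]
      exact pow_le_pow_left₀ hN0.le hfl 2
    have b2 : (N:ℝ)^2 / Real.log N ≤ (c^2 * (n * Real.log n)) / (Real.log n / 2) := by
      gcongr
    have b3 : (c^2 * (n * Real.log n)) / (Real.log n / 2) = 2 * c^2 * n := by
      field_simp
    rw [b3] at b2
    rw [one_div, inv_mul_le_iff₀ (by positivity)]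
    exact b2
  obtain ⟨f, hf⟩ := lowerT n N (by exact_mod_cast hPn)
  have hθ0 : 0 < θ (N:ℝ) := by
    apply theta_pos
    have : (3:ℝ) ≤ N := by exact_mod_cast h3
    linarith
  have hTpos : 0 < T f := by
    rcases Nat.eq_zero_or_pos (T f) with h | h
    · rw [h] at hf; simp at hf; linarith
    · exact h
  have hle : T f ≤ Finset.univ.sup fun f : Fin n → Fin n => T f :=
    Finset.le_sup (f := fun f : Fin n → Fin n => T f) (Finset.mem_univ f)
  have hlogle := Real.log_le_log (Nat.cast_pos.2 hTpos)
    (Nat.cast_le (α := ℝ).2 hle)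
  have e1 : θ (N:ℝ) / N * (N / X n) = θ (N:ℝ) / X n := by field_simp
  rw [e1]
  exact div_le_div_of_nonneg_right (hf.trans hlogle) hX.le

/-- `log(max_f T(f)) = √(n log n)(1 + o(1))`. -/
theorem max_T_asymp :
    Filter.Tendsto
      (fun n : ℕ =>
        Real.log ((Finset.univ.sup fun f : Fin n → Fin n => T f : ℕ) : ℝ) /
          Real.sqrt ((n : ℝ) * Real.log n))
      Filter.atTop (nhds 1) :=
  tendsto_order.2 ⟨lower_ev, upper_ev⟩

end IterMap
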